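/- arXiv:0905.1082 — 2 statements merged into one kernel-verified Lean document; each statement's English description precedes it below -/
import Mathlib

section
/- Let k be an infinite field of characteristic p ≠ 2 (so p = 0 or p is an odd prime) and let m ≥ 2 be an integer. Let t ≥ 1 and s ≥ 0 be integers and let α_1, …, α_{t+2s} be nonnegative integers with α_r ≥ 1 for 1 ≤ r ≤ t. Set u = (∏_{r=1}^{t} x_r^{α_r}) · ∏_{r=1}^{s} [x_{t+2r−1}, x_{t+2r}] x_{t+2r−1}^{α_{t+2r−1}} x_{t+2r}^{α_{t+2r}} ∈ k⟨X⟩. Then u ∈ CP(G(m)) if and only if either 2s ≥ m − 1, or p > 2 and p divides α_a for every a with 1 ≤ a ≤ t. -/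
noncomputable section

/-- The `i`-th variable `x_i` of the free unital associative algebra `k⟨X⟩`. -/
def xx (k : Type*) [Field k] (i : ℕ) : FreeAlgebra k ℕ := FreeAlgebra.ι k i

/-- Commutator `[a,b] = ab - ba`. -/
def brk {A : Type*} [Ring A] (a b : A) : A := a * b - b * a

/-- The odd part of an exterior algebra: the span of the vectors over the centre. -/
def oddPart (k M : Type*) [Field k] [AddCommGroup M] [Module k M] :
    Submodule (Subring.center (ExteriorAlgebra k M)) (ExteriorAlgebra k M) :=
  Submodule.span _ (Set.range (ExteriorAlgebra.ι k))

section OddPart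

variable {k M : Type*} [Field k] [AddCommGroup M] [Module k M]

theorem ι_mul_ι_anticomm (v w : M) :
    ExteriorAlgebra.ι k v * ExteriorAlgebra.ι k w =
      -(ExteriorAlgebra.ι k w * ExteriorAlgebra.ι k v) :=
  eq_neg_of_add_eq_zero_left (ExteriorAlgebra.ι_add_mul_swap v w)

theorem mem_center_of_commute_ι {x : ExteriorAlgebra k M}
    (h : ∀ v : M, ExteriorAlgebra.ι k v * x = x * ExteriorAlgebra.ι k v) :
    x ∈ Subring.center (ExteriorAlgebra k M) := by
  rw [Subring.mem_center_iff]
  intro b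
  induction b using ExteriorAlgebra.induction with
  | algebraMap r => exact Algebra.commutes r x
  | ι v => exact h v
  | mul a b ha hb => rw [mul_assoc, hb, ← mul_assoc, ha, mul_assoc]
  | add a b ha hb => rw [add_mul, mul_add, ha, hb]

theorem ι_mul_ι_mem_center (v w : M) :
    ExteriorAlgebra.ι k v * ExteriorAlgebra.ι k w ∈
      Subring.center (ExteriorAlgebra k M) := by
  refine mem_center_of_commute_ι fun u => ?_
  rw [← mul_assoc, ι_mul_ι_anticomm u v, neg_mul, mul_assoc, ι_mul_ι_anticomm u w, mul_neg,
    neg_neg, mul_assoc]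

theorem ι_mem_oddPart (v : M) : ExteriorAlgebra.ι k v ∈ oddPart k M :=
  Submodule.subset_span ⟨v, rfl⟩

theorem center_mul_mem_oddPart_pow {z x : ExteriorAlgebra k M} {n : ℕ}
    (hz : z ∈ Subring.center (ExteriorAlgebra k M)) (hx : x ∈ oddPart k M ^ n) :
    z * x ∈ oddPart k M ^ n :=
  (oddPart k M ^ n).smul_mem ⟨z, hz⟩ hx

theorem oddPart_mul_mem_center {x y : ExteriorAlgebra k M} (hx : x ∈ oddPart k M)
    (hy : y ∈ oddPart k M) : x * y ∈ Subring.center (ExteriorAlgebra k M) := by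
  induction hx, hy using Submodule.span_induction₂ with
  | mem_mem x y hx hy =>
    obtain ⟨v, rfl⟩ := hx
    obtain ⟨w, rfl⟩ := hy
    exact ι_mul_ι_mem_center v w
  | zero_left y hy => simp
  | zero_right x hx => simp
  | add_left x y z _ _ _ h₁ h₂ => rw [add_mul]; exact add_mem h₁ h₂
  | add_right x y z _ _ _ h₁ h₂ => rw [mul_add]; exact add_mem h₁ h₂
  | smul_left r x y _ _ h => rw [smul_mul_assoc]; exact mul_mem r.2 h
  | smul_right r x y _ _ h => rw [mul_smul_comm]; exact mul_mem r.2 h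

theorem oddPart_anticomm {x y : ExteriorAlgebra k M} (hx : x ∈ oddPart k M)
    (hy : y ∈ oddPart k M) : x * y = -(y * x) := by
  induction hx, hy using Submodule.span_induction₂ with
  | mem_mem x y hx hy =>
    obtain ⟨v, rfl⟩ := hx
    obtain ⟨w, rfl⟩ := hy
    exact ι_mul_ι_anticomm v w
  | zero_left y hy => simp
  | zero_right x hx => simp
  | add_left x y z _ _ _ h₁ h₂ => rw [add_mul, mul_add, h₁, h₂, neg_add]
  | add_right x y z _ _ _ h₁ h₂ => rw [mul_add, add_mul, h₁, h₂, neg_add]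
  | smul_left r x y _ _ h => rw [smul_mul_assoc, mul_smul_comm, h, smul_neg]
  | smul_right r x y _ _ h => rw [smul_mul_assoc, mul_smul_comm, h, smul_neg]

theorem oddPart_mul_self {x : ExteriorAlgebra k M} (hx : x ∈ oddPart k M) : x * x = 0 := by
  induction hx using Submodule.span_induction with
  | mem x hx =>
    obtain ⟨v, rfl⟩ := hx
    exact ExteriorAlgebra.ι_sq_zero v
  | zero => simp
  | add x y hx hy h₁ h₂ =>
    rw [add_mul, mul_add, mul_add, h₁, h₂, oddPart_anticomm hx hy]
    simp
  | smul r x _ h => rw [smul_mul_assoc, mul_smul_comm, h, smul_zero, smul_zero]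

theorem exists_center_add_oddPart (x : ExteriorAlgebra k M) :
    ∃ z ∈ Subring.center (ExteriorAlgebra k M), ∃ o ∈ oddPart k M, x = z + o := by
  induction x using ExteriorAlgebra.induction with
  | algebraMap r => exact ⟨_, Subring.mem_center_iff.2 fun b => (Algebra.commutes r b).symm, 0, zero_mem _, (add_zero _).symm⟩
  | ι v => exact ⟨0, zero_mem _, _, ι_mem_oddPart v, (zero_add _).symm⟩
  | mul a b ha hb =>
    obtain ⟨z, hz, o, ho, rfl⟩ := ha
    obtain ⟨z', hz', o', ho', rfl⟩ := hb
    refine ⟨z * z' + o * o', add_mem (mul_mem hz hz') (oddPart_mul_mem_center ho ho'),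
      z * o' + z' * o, add_mem ?_ ?_, ?_⟩
    · exact (oddPart k M).smul_mem ⟨z, hz⟩ ho'
    · exact (oddPart k M).smul_mem ⟨z', hz'⟩ ho
    · rw [← Subring.mem_center_iff.1 hz' o]
      noncomm_ring
  | add a b ha hb =>
    obtain ⟨z, hz, o, ho, rfl⟩ := ha
    obtain ⟨z', hz', o', ho', rfl⟩ := hb
    exact ⟨z + z', add_mem hz hz', o + o', add_mem ho ho', add_add_add_comm _ _ _ _⟩

theorem oddPart_pow_eq_bot {m n : ℕ} (h : m < n) : oddPart k (Fin m → k) ^ n = ⊥ := by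
  rw [oddPart, Submodule.span_pow, Submodule.span_eq_bot]
  intro x hx
  have hx' : x ∈ LinearMap.range (ExteriorAlgebra.ι k (M := Fin m → k)) ^ n :=
    Submodule.pow_subset_pow _ (by rwa [LinearMap.coe_range])
  change x ∈ ⋀[k]^n (Fin m → k) at hx'
  rw [← ExteriorAlgebra.ιMulti_span_fixedDegree] at hx'
  have hz : Submodule.span k (Set.range (ExteriorAlgebra.ιMulti k n (M := Fin m → k))) = ⊥ := by
    rw [Submodule.span_eq_bot]
    rintro _ ⟨v, rfl⟩
    refine AlternatingMap.map_linearDependent _ _ fun hv => ?_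
    have := hv.fintype_card_le_finrank
    simp at this
    omega
  rwa [hz, Submodule.mem_bot] at hx'

theorem brk_center_add_oddPart {z z' o o' : ExteriorAlgebra k M}
    (hz : z ∈ Subring.center (ExteriorAlgebra k M))
    (hz' : z' ∈ Subring.center (ExteriorAlgebra k M))
    (ho : o ∈ oddPart k M) (ho' : o' ∈ oddPart k M) :
    brk (z + o) (z' + o') = 2 * (o * o') := by
  have h₁ := Subring.mem_center_iff.1 hz
  have h₂ := Subring.mem_center_iff.1 hz'
  have h₃ := oddPart_anticomm ho' ho
  simp only [brk, add_mul, mul_add, h₁, ← h₂, h₃, two_mul]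
  abel

theorem brk_mem_center (x y : ExteriorAlgebra k M) :
    brk x y ∈ Subring.center (ExteriorAlgebra k M) := by
  obtain ⟨z, hz, o, ho, rfl⟩ := exists_center_add_oddPart x
  obtain ⟨z', hz', o', ho', rfl⟩ := exists_center_add_oddPart y
  rw [brk_center_add_oddPart hz hz' ho ho', two_mul]
  exact add_mem (oddPart_mul_mem_center ho ho') (oddPart_mul_mem_center ho ho')

theorem brk_mem_oddPart_sq (x y : ExteriorAlgebra k M) : brk x y ∈ oddPart k M ^ 2 := by
  obtain ⟨z, hz, o, ho, rfl⟩ := exists_center_add_oddPart x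
  obtain ⟨z', hz', o', ho', rfl⟩ := exists_center_add_oddPart y
  rw [brk_center_add_oddPart hz hz' ho ho', two_mul, sq]
  exact add_mem (Submodule.mul_mem_mul ho ho') (Submodule.mul_mem_mul ho ho')

theorem brk_mul_pow_mul_pow (x y : ExteriorAlgebra k M) (a b : ℕ) :
    ∃ z ∈ Subring.center (ExteriorAlgebra k M), brk x y * x ^ a * y ^ b = z * brk x y := by
  obtain ⟨z, hz, o, ho, rfl⟩ := exists_center_add_oddPart x
  obtain ⟨z', hz', o', ho', rfl⟩ := exists_center_add_oddPart y
  have hb := brk_center_add_oddPart hz hz' ho ho'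
  have hpow : ∀ (c w q : ExteriorAlgebra k M) (n : ℕ), c * q = 0 →
      w ∈ Subring.center (ExteriorAlgebra k M) → c * (w + q) ^ n = w ^ n * c := by
    intro c w q n hc hw
    induction n with
    | zero => simp
    | succ n ih =>
      rw [pow_succ, ← mul_assoc, ih, mul_assoc, mul_add, hc, add_zero,
        Subring.mem_center_iff.1 hw, pow_succ, mul_assoc]
  have h₁ : brk (z + o) (z' + o') * o = 0 := by
    rw [hb, oddPart_anticomm ho ho', mul_neg, neg_mul, mul_assoc, mul_assoc,
      oddPart_mul_self ho]
    simp
  have h₂ : brk (z + o) (z' + o') * o' = 0 := by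
    rw [hb, mul_assoc, mul_assoc, oddPart_mul_self ho']
    simp
  refine ⟨z ^ a * z' ^ b, mul_mem (pow_mem hz a) (pow_mem hz' b), ?_⟩
  rw [hpow _ _ _ _ h₁ hz, mul_assoc, hpow _ _ _ _ h₂ hz', mul_assoc]

theorem pow_mem_center_of_dvd {p : ℕ} [CharP k p] (hp : p.Prime) {n : ℕ} (h : p ∣ n)
    (x : ExteriorAlgebra k M) : x ^ n ∈ Subring.center (ExteriorAlgebra k M) := by
  obtain ⟨c, rfl⟩ := h
  rw [pow_mul]
  refine pow_mem ?_ c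
  obtain ⟨z, hz, o, ho, rfl⟩ := exists_center_add_oddPart x
  have := Fact.mk hp
  have : CharP (ExteriorAlgebra k M) p :=
    charP_of_injective_algebraMap (algebraMap k (ExteriorAlgebra k M)).injective p
  have hcomm : Commute z o := (Subring.mem_center_iff.1 hz o).symm
  rw [add_pow_char_of_commute _ hcomm]
  have ho0 : o ^ p = 0 := by
    obtain ⟨q, rfl⟩ := Nat.exists_eq_add_of_le hp.two_le
    rw [pow_add, sq, oddPart_mul_self ho, zero_mul]
  rw [ho0, add_zero]
  exact pow_mem hz p

theorem prod_brk_mem (s : ℕ) (x y : ℕ → ExteriorAlgebra k M) (a b : ℕ → ℕ) :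
    ((List.range s).map fun r => brk (x r) (y r) * x r ^ a r * y r ^ b r).prod ∈
        Subring.center (ExteriorAlgebra k M) ∧
      ((List.range s).map fun r => brk (x r) (y r) * x r ^ a r * y r ^ b r).prod ∈
        oddPart k M ^ (2 * s) := by
  induction s with
  | zero => simp [one_mem, Submodule.one_le.1 le_rfl]
  | succ s ih =>
    obtain ⟨z, hz, h⟩ := brk_mul_pow_mul_pow (x s) (y s) (a s) (b s)
    rw [List.range_succ, List.map_append, List.prod_append, List.map_singleton,
      List.prod_singleton, h, Nat.mul_succ, pow_add]
    exact ⟨mul_mem ih.1 (mul_mem hz (brk_mem_center _ _)), Submodule.mul_mem_mul ih.2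
      (center_mul_mem_oddPart_pow hz (brk_mem_oddPart_sq _ _))⟩

end OddPart

/-- The `i`-th standard generator of the exterior algebra of `k^m`, and `0` for `m ≤ i`. -/
def stdGen (k : Type*) [Field k] (m i : ℕ) : ExteriorAlgebra k (Fin m → k) :=
  ExteriorAlgebra.ι k fun j => if (j : ℕ) = i then 1 else 0

section StdGen

variable {k : Type*} [Field k]

theorem stdGen_mem_oddPart (m i : ℕ) : stdGen k m i ∈ oddPart k (Fin m → k) :=
  ι_mem_oddPart _

theorem prod_stdGen_ne_zero {m n : ℕ} (h : n ≤ m) :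
    ((List.range n).map (stdGen k m)).prod ≠ 0 := by
  intro h0
  let g : (Fin m → k) [⋀^Fin n]→ₗ[k] k :=
    (Matrix.detRowAlternating (R := k) (n := Fin n)).compLinearMap
      (LinearMap.funLeft k k (Fin.castLE h))
  let f : ∀ i, (Fin m → k) [⋀^Fin i]→ₗ[k] k := fun i =>
    if hi : i = n then g.domDomCongr (finCongr hi.symm) else 0
  let v : Fin n → Fin m → k := fun i j => if (j : ℕ) = i then 1 else 0
  have h1 : ExteriorAlgebra.ιMulti k n v = 0 := by
    rw [← h0, ExteriorAlgebra.ιMulti_apply, List.ofFn_eq_map, ← List.map_coe_finRange_eq_range,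
      List.map_map]
    rfl
  have h2 := ExteriorAlgebra.liftAlternating_apply_ιMulti f v
  rw [h1, map_zero] at h2
  have h3 : f n v = 1 := by
    have hM : (fun i : Fin n => LinearMap.funLeft k k (Fin.castLE h) (v i)) =
        (1 : Matrix (Fin n) (Fin n) k) := by
      ext i j
      simp [v, LinearMap.funLeft_apply, Matrix.one_apply, Fin.ext_iff, eq_comm]
    have : f n v = Matrix.det (fun i : Fin n => LinearMap.funLeft k k (Fin.castLE h) (v i)) := by
      simp [f, g]
      rfl
    rw [this, hM, Matrix.det_one]
  rw [h3] at h2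
  exact zero_ne_one h2

theorem stdGen_mul_prod_eq (m s : ℕ) :
    stdGen k m 0 * ((List.range s).map fun r =>
        stdGen k m (2 * r + 1) * stdGen k m (2 * r + 2)).prod =
      ((List.range (2 * s + 1)).map (stdGen k m)).prod := by
  induction s with
  | zero => simp
  | succ s ih =>
    rw [show 2 * (s + 1) + 1 = 2 * s + 1 + 1 + 1 by ring]
    rw [List.range_succ (n := 2 * s + 1 + 1), List.range_succ (n := 2 * s + 1), List.range_succ]
    simp only [List.map_append, List.prod_append, List.map_singleton, List.prod_singleton, ← ih,
      mul_assoc]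

end StdGen

theorem one_add_pow_of_mul_self {A : Type*} [Ring A] {x : A} (hx : x * x = 0) (n : ℕ) :
    (1 + x) ^ n = 1 + n * x := by
  induction n with
  | zero => simp
  | succ n ih =>
    rw [pow_succ, ih, add_mul, mul_add, mul_assoc, mul_add, hx]
    push_cast
    noncomm_ring

theorem List.prod_map_range_ite {A : Type*} [Monoid A] (c : A) (b n : ℕ) :
    ((List.range n).map fun r => if r = b then c else 1).prod = if b < n then c else 1 := by
  induction n with
  | zero => simp
  | succ n ih =>
    rw [List.range_succ, List.map_append, List.prod_append, ih]
    simp only [List.map_singleton, List.prod_singleton]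
    split_ifs <;> first | omega | simp

theorem prod_brk_one_add_stdGen {k : Type*} [Field k] (m s : ℕ) (a b : ℕ → ℕ) :
    ((List.range s).map fun r =>
      brk (1 + stdGen k m (2 * r + 1)) (1 + stdGen k m (2 * r + 2)) *
        (1 + stdGen k m (2 * r + 1)) ^ a r * (1 + stdGen k m (2 * r + 2)) ^ b r).prod =
      2 ^ s * ((List.range s).map fun r =>
        stdGen k m (2 * r + 1) * stdGen k m (2 * r + 2)).prod := by
  induction s with
  | zero => simp
  | succ s ih =>
    rw [List.range_succ, List.map_append, List.prod_append, ih, List.map_append,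
      List.prod_append]
    simp only [List.map_singleton, List.prod_singleton]
    set W := ((List.range s).map fun r =>
        stdGen k m (2 * r + 1) * stdGen k m (2 * r + 2)).prod
    have ho := stdGen_mem_oddPart (k := k) m (2 * s + 1)
    have ho' := stdGen_mem_oddPart (k := k) m (2 * s + 2)
    generalize stdGen k m (2 * s + 1) = x at *
    generalize stdGen k m (2 * s + 2) = y at *
    have hxx := oddPart_mul_self ho
    have hyy := oddPart_mul_self ho'
    have hyx := oddPart_anticomm ho' ho
    have hb : brk (1 + x) (1 + y) = 2 * (x * y) :=
      brk_center_add_oddPart (one_mem _) (one_mem _) ho ho'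
    have h1 : x * y * (1 + x) ^ a s = x * y := by
      have : x * y * x = 0 := by rw [mul_assoc, hyx, mul_neg, ← mul_assoc, hxx]; simp
      rw [one_add_pow_of_mul_self hxx, mul_add, mul_one, ← nsmul_eq_mul, mul_smul_comm, this]
      simp
    have h2 : x * y * (1 + y) ^ b s = x * y := by
      rw [one_add_pow_of_mul_self hyy, mul_add, mul_one, ← nsmul_eq_mul, mul_smul_comm,
        mul_assoc, hyy]
      simp
    rw [hb, mul_assoc 2, h1, mul_assoc 2, h2, pow_succ, mul_assoc, mul_assoc, ← mul_assoc W 2,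
      (Commute.ofNat_right W 2).eq, mul_assoc]

/-- Let `k` be an infinite field of characteristic `p ≠ 2`, `m ≥ 2`,
`t ≥ 1`, `s ≥ 0`, and `α_r ≥ 1` for `1 ≤ r ≤ t`.  Then
`u = (∏_{r=1}^{t} x_r^{α_r}) ∏_{r=1}^{s} [x_{t+2r-1}, x_{t+2r}] x_{t+2r-1}^{α_{t+2r-1}} x_{t+2r}^{α_{t+2r}}`
is a central polynomial of `G(m)` iff `2s ≥ m - 1`, or `p > 2` and `p ∣ α_a` for all
`1 ≤ a ≤ t`. -/
theorem stmt4 (k : Type*) [Field k] [Infinite k] (p : ℕ) [CharP k p] (hp : p ≠ 2)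
    (m : ℕ) (hm : 2 ≤ m) (t s : ℕ) (ht : 1 ≤ t) (α : ℕ → ℕ)
    (hα : ∀ r, 1 ≤ r → r ≤ t → 1 ≤ α r) :
    (((List.range t).map (fun r => (xx k (r + 1)) ^ (α (r + 1)))).prod *
      ((List.range s).map (fun r =>
        brk (xx k (t + 2 * r + 1)) (xx k (t + 2 * r + 2)) *
          (xx k (t + 2 * r + 1)) ^ (α (t + 2 * r + 1)) *
          (xx k (t + 2 * r + 2)) ^ (α (t + 2 * r + 2)))).prod
      ∈ {f : FreeAlgebra k ℕ |
          ∀ φ : FreeAlgebra k ℕ →ₐ[k] ExteriorAlgebra k (Fin m → k),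
            ∀ a, φ f * a = a * φ f})
    ↔ (m - 1 ≤ 2 * s ∨ (2 < p ∧ ∀ a, 1 ≤ a → a ≤ t → p ∣ α a)) := by
  have key : ∀ φ : FreeAlgebra k ℕ →ₐ[k] ExteriorAlgebra k (Fin m → k),
      φ (((List.range t).map (fun r => (xx k (r + 1)) ^ (α (r + 1)))).prod *
      ((List.range s).map (fun r =>
        brk (xx k (t + 2 * r + 1)) (xx k (t + 2 * r + 2)) *
          (xx k (t + 2 * r + 1)) ^ (α (t + 2 * r + 1)) *
          (xx k (t + 2 * r + 2)) ^ (α (t + 2 * r + 2)))).prod) =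
      ((List.range t).map (fun r => φ (xx k (r + 1)) ^ (α (r + 1)))).prod *
      ((List.range s).map (fun r =>
        brk (φ (xx k (t + 2 * r + 1))) (φ (xx k (t + 2 * r + 2))) *
          φ (xx k (t + 2 * r + 1)) ^ (α (t + 2 * r + 1)) *
          φ (xx k (t + 2 * r + 2)) ^ (α (t + 2 * r + 2)))).prod := by
    intro φ
    simp only [map_mul, map_list_prod, List.map_map, Function.comp_def, map_pow, brk, map_sub]
  simp only [Set.mem_ofPred_eq, key]
  constructor
  · intro h
    by_contra! hcon
    obtain ⟨hs, hdiv⟩ := hcon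
    obtain ⟨a, ha1, hat, hak⟩ : ∃ a, 1 ≤ a ∧ a ≤ t ∧ (α a : k) ≠ 0 := by
      by_cases hp2 : 2 < p
      · obtain ⟨a, h1, h2, h3⟩ := hdiv hp2
        exact ⟨a, h1, h2, fun h0 => h3 ((CharP.cast_eq_zero_iff k p _).1 h0)⟩
      · refine ⟨1, le_rfl, ht, fun h0 => ?_⟩
        have h1 := hα 1 le_rfl ht
        rw [CharP.cast_eq_zero_iff k p] at h0
        rcases CharP.char_is_prime_or_zero k p with hpp | hpp
        · have := hpp.two_le
          omega
        · rw [hpp, zero_dvd_iff] at h0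
          omega
    have h2k : (2 : k) ≠ 0 := Ring.two_ne_zero (by rwa [ringChar.eq k p])
    let f : ℕ → ExteriorAlgebra k (Fin m → k) := fun i =>
      if i = a then 1 + stdGen k m 0 else if i ≤ t then 1 else 1 + stdGen k m (i - t)
    have hf : ∀ i, FreeAlgebra.lift k f (xx k i) = f i := fun i => FreeAlgebra.lift_ι_apply f i
    have hcent := h (FreeAlgebra.lift k f) (stdGen k m (2 * s + 1))
    simp only [hf] at hcent
    have hf1 : ∀ r, f (t + 2 * r + 1) = 1 + stdGen k m (2 * r + 1) := fun r => by
      simp only [f]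
      rw [if_neg (by omega), if_neg (by omega), show t + 2 * r + 1 - t = 2 * r + 1 by omega]
    have hf2 : ∀ r, f (t + 2 * r + 2) = 1 + stdGen k m (2 * r + 2) := fun r => by
      simp only [f]
      rw [if_neg (by omega), if_neg (by omega), show t + 2 * r + 2 - t = 2 * r + 2 by omega]
    have hfirst : ((List.range t).map fun r => f (r + 1) ^ α (r + 1)).prod =
        1 + (α a : ExteriorAlgebra k (Fin m → k)) * stdGen k m 0 := by
      have hmap : ((List.range t).map fun r => f (r + 1) ^ α (r + 1)) =
          (List.range t).map fun r =>
            if r = a - 1 then (1 + stdGen k m 0) ^ α a else 1 := by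
        refine List.map_congr_left fun r hr => ?_
        rw [List.mem_range] at hr
        by_cases hra : r + 1 = a
        · simp [f, ← hra]
        · simp only [f]
          rw [if_neg hra, if_pos (by omega), if_neg (by omega), one_pow]
      rw [hmap, List.prod_map_range_ite, if_pos (by omega),
        one_add_pow_of_mul_self (oddPart_mul_self (stdGen_mem_oddPart m 0))]
    simp only [hf1, hf2, hfirst] at hcent
    have hWc := (prod_brk_mem s (fun r => 1 + stdGen k m (2 * r + 1))
      (fun r => 1 + stdGen k m (2 * r + 2)) (fun r => α (t + 2 * r + 1))
      (fun r => α (t + 2 * r + 2))).1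
    rw [prod_brk_one_add_stdGen m s (fun r => α (t + 2 * r + 1))
      (fun r => α (t + 2 * r + 2))] at hcent hWc
    have hne := prod_stdGen_ne_zero (k := k) (m := m) (n := 2 * s + 1 + 1) (by omega)
    rw [List.range_succ, List.map_append, List.prod_append, ← stdGen_mul_prod_eq] at hne
    simp only [List.map_singleton, List.prod_singleton] at hne
    set W := ((List.range s).map fun r =>
        stdGen k m (2 * r + 1) * stdGen k m (2 * r + 2)).prod
    have hanti := oddPart_anticomm (stdGen_mem_oddPart (k := k) m (2 * s + 1))
      (stdGen_mem_oddPart m 0)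
    generalize stdGen k m (2 * s + 1) = y at *
    generalize stdGen k m 0 = x at *
    have hWy := Subring.mem_center_iff.1 hWc y
    have e1 : (2 ^ (s + 1) * α a : k) • (x * W * y) = 0 := by
      have hyx : y * ((α a : ExteriorAlgebra k (Fin m → k)) * x * (2 ^ s * W)) =
          -((α a : ExteriorAlgebra k (Fin m → k)) * x * (2 ^ s * W) * y) := by
        rw [mul_assoc _ (2 ^ s * W) y, ← hWy, ← mul_assoc, ← mul_assoc, ← mul_assoc y,
          ← (Nat.cast_commute (α a) y).eq, mul_assoc _ y x, hanti]
        noncomm_ring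
      rw [add_mul, one_mul, add_mul, mul_add, hWy, hyx, add_right_inj,
        eq_neg_iff_add_eq_zero, ← two_mul] at hcent
      rw [← hcent, Algebra.smul_def, map_mul, map_pow, map_natCast, map_ofNat, pow_succ']
      have hc : Commute ((2 : ExteriorAlgebra k (Fin m → k)) ^ s)
          ((α a : ExteriorAlgebra k (Fin m → k)) * x) :=
        (Commute.ofNat_left 2 _).pow_left s
      have := hc.eq
      calc _ = 2 * ((2 ^ s * ((α a : ExteriorAlgebra k (Fin m → k)) * x)) * W * y) := by
            simp only [mul_assoc]
        _ = _ := by rw [this]; simp only [mul_assoc]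
    rcases smul_eq_zero.1 e1 with e2 | e2
    · exact mul_ne_zero (pow_ne_zero _ h2k) hak e2
    · exact hne e2
  · intro h φ x
    have hw := prod_brk_mem s (fun r => φ (xx k (t + 2 * r + 1)))
      (fun r => φ (xx k (t + 2 * r + 2))) (fun r => α (t + 2 * r + 1))
      (fun r => α (t + 2 * r + 2))
    generalize ((List.range s).map fun r => brk (φ (xx k (t + 2 * r + 1)))
      (φ (xx k (t + 2 * r + 2))) * φ (xx k (t + 2 * r + 1)) ^ α (t + 2 * r + 1) *
      φ (xx k (t + 2 * r + 2)) ^ α (t + 2 * r + 2)).prod = w at *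
    rcases h with h | ⟨hp2, hdiv⟩
    · generalize ((List.range t).map fun r => φ (xx k (r + 1)) ^ α (r + 1)).prod = v
      have hmem := Submodule.mul_mem_mul (brk_mem_oddPart_sq v x) hw.2
      rw [← pow_add, oddPart_pow_eq_bot (by omega), Submodule.mem_bot, brk, sub_mul,
        sub_eq_zero] at hmem
      rw [mul_assoc, ← Subring.mem_center_iff.1 hw.1 x, ← mul_assoc, hmem, mul_assoc]
    · have hpp : p.Prime := (CharP.char_is_prime_or_zero k p).resolve_right (by omega)
      have hv : ((List.range t).map fun r => φ (xx k (r + 1)) ^ α (r + 1)).prod ∈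
          Subring.center (ExteriorAlgebra k (Fin m → k)) := by
        refine list_prod_mem fun y hy => ?_
        obtain ⟨r, hr, rfl⟩ := List.mem_map.1 hy
        rw [List.mem_range] at hr
        exact pow_mem_center_of_dvd hpp (hdiv (r + 1) (by omega) (by omega)) _
      exact (Subring.mem_center_iff.1 (mul_mem hv hw.1) x).symm

end
end

section
/- Let k be a field of characteristic different from 2, let m ≥ 2 be an integer, and set b_m = ⌊m/2⌋ + 1. Then for any elements g_0, g_1, …, g_{2(b_m−1)} of G(m), the element g_0 · ∏_{r=1}^{b_m−1} [g_{2r−1}, g_{2r}] lies in the center of G(m). Consequently the polynomial x_{2b_m−1} · h_{b_m−1} belongs to CP(G(m)). -/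
noncomputable section

/-- `h_j = ∏_{r=1}^{j} [x_{2r-1}, x_{2r}]`. -/
def hh (k : Type*) [Field k] (j : ℕ) : FreeAlgebra k ℕ :=
  ((List.range j).map (fun r => brk (xx k (2 * r + 1)) (xx k (2 * r + 2)))).prod

namespace ExteriorAlgebra

section CommRing

variable {R M : Type*} [CommRing R] [AddCommGroup M] [Module R M]

theorem commute_of_mem_even {x : ExteriorAlgebra R M}
    (hx : x ∈ CliffordAlgebra.evenOdd (0 : QuadraticForm R M) 0) (y : ExteriorAlgebra R M) :
    Commute x y := by
  have swap (u v : M) : ι R u * ι R v = -(ι R v * ι R u) :=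
    eq_neg_of_add_eq_zero_left (ι_add_mul_swap u v)
  have key (u v : M) (y : ExteriorAlgebra R M) : Commute (ι R u * ι R v) y := by
    induction y using ExteriorAlgebra.induction with
    | algebraMap r => exact (Algebra.commutes r _).symm
    | ι w =>
      change ι R u * ι R v * ι R w = ι R w * (ι R u * ι R v)
      rw [mul_assoc, swap v w, mul_neg, ← mul_assoc, swap u w, neg_mul, neg_neg, mul_assoc]
    | mul a b ha hb => exact ha.mul_right hb
    | add a b ha hb => exact ha.add_right hb
  induction x, hx using CliffordAlgebra.even_induction with
  | algebraMap r => exact Algebra.commutes r y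
  | add _ _ _ _ ha hb => exact ha.add_left hb
  | ι_mul_ι_mul u v _ _ ih => exact (key u v y).mul_left ih

theorem commute_brk (a b y : ExteriorAlgebra R M) : Commute (brk a b) y := by
  have decomp (x : ExteriorAlgebra R M) :
      ∃ e ∈ CliffordAlgebra.evenOdd (0 : QuadraticForm R M) 0,
        ∃ o ∈ CliffordAlgebra.evenOdd (0 : QuadraticForm R M) 1, e + o = x :=
    Submodule.mem_sup.1 <| by
      rw [(CliffordAlgebra.evenOdd_isCompl (Q := (0 : QuadraticForm R M))).sup_eq_top]
      exact Submodule.mem_top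
  obtain ⟨e, he, o, ho, rfl⟩ := decomp a
  obtain ⟨e', he', o', ho', rfl⟩ := decomp b
  have hbrk : brk (e + o) (e' + o') = o * o' - o' * o := by
    have h₁ := (commute_of_mem_even he (e' + o')).eq
    have h₂ := (commute_of_mem_even he' o).eq
    rw [brk, add_mul, h₁, mul_add _ e o, mul_add o, add_mul e' o' o, h₂]
    abel
  have mul_mem {p q : ExteriorAlgebra R M}
      (hp : p ∈ CliffordAlgebra.evenOdd (0 : QuadraticForm R M) 1)
      (hq : q ∈ CliffordAlgebra.evenOdd (0 : QuadraticForm R M) 1) :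
      p * q ∈ CliffordAlgebra.evenOdd (0 : QuadraticForm R M) 0 :=
    CliffordAlgebra.evenOdd_mul_le _ 1 1 (Submodule.mul_mem_mul hp hq)
  rw [hbrk]
  exact commute_of_mem_even (sub_mem (mul_mem ho ho') (mul_mem ho' ho)) y

variable (R M) in
/-- The ideal of elements of degree at least `j`, as an `R`-submodule. -/
def degreeGE (j : ℕ) : Submodule R (ExteriorAlgebra R M) :=
  LinearMap.range (ι R : M →ₗ[R] ExteriorAlgebra R M) ^ j * ⊤

theorem top_mul_range_ι_pow (j : ℕ) :
    ⊤ * LinearMap.range (ι R : M →ₗ[R] ExteriorAlgebra R M) ^ j = degreeGE R M j := by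
  have h : ⨆ i : ℕ, LinearMap.range (ι R : M →ₗ[R] ExteriorAlgebra R M) ^ i = ⊤ :=
    CliffordAlgebra.iSup_ι_range_eq_top 0
  rw [degreeGE, ← h, Submodule.iSup_mul, Submodule.mul_iSup]
  exact iSup_congr fun i => (Commute.pow_pow_self _ i j).eq

theorem mul_mem_degreeGE {i j : ℕ} {x y : ExteriorAlgebra R M} (hx : x ∈ degreeGE R M i)
    (hy : y ∈ degreeGE R M j) : x * y ∈ degreeGE R M (i + j) := by
  have h := Submodule.mul_mem_mul hx hy
  rw [degreeGE, degreeGE, mul_assoc, ← mul_assoc ⊤, top_mul_range_ι_pow, degreeGE, mul_assoc,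
    ← mul_assoc, ← pow_add] at h
  exact (mul_le_mul_right le_top (LinearMap.range (ι R) ^ (i + j))) h

theorem range_ι_pow_le_degreeGE {i j : ℕ} (h : j ≤ i) :
    LinearMap.range (ι R : M →ₗ[R] ExteriorAlgebra R M) ^ i ≤ degreeGE R M j := by
  rw [← Nat.add_sub_of_le h, pow_add]
  exact mul_le_mul_right le_top _

theorem brk_mem_degreeGE (a b : ExteriorAlgebra R M) : brk a b ∈ degreeGE R M 2 := by
  have h : ⨆ i : ℕ, LinearMap.range (ι R : M →ₗ[R] ExteriorAlgebra R M) ^ i = ⊤ :=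
    CliffordAlgebra.iSup_ι_range_eq_top 0
  have ha : a ∈ ⨆ i : ℕ, LinearMap.range (ι R : M →ₗ[R] ExteriorAlgebra R M) ^ i :=
    h ▸ Submodule.mem_top
  have hb : b ∈ ⨆ i : ℕ, LinearMap.range (ι R : M →ₗ[R] ExteriorAlgebra R M) ^ i :=
    h ▸ Submodule.mem_top
  induction ha using Submodule.iSup_induction' with
  | zero => simp [brk]
  | add x y _ _ hx hy =>
    have : brk (x + y) b = brk x b + brk y b := by simp only [brk]; noncomm_ring
    exact this ▸ add_mem hx hy
  | mem i x hx =>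
    induction hb using Submodule.iSup_induction' with
    | zero => simp [brk]
    | add y z _ _ hy hz =>
      have : brk x (y + z) = brk x y + brk x z := by simp only [brk]; noncomm_ring
      exact this ▸ add_mem hy hz
    | mem j y hy =>
      rcases Nat.eq_zero_or_pos i with rfl | hi
      · obtain ⟨r, rfl⟩ := Submodule.mem_one.1 (by rwa [pow_zero] at hx)
        simp [brk, Algebra.commutes r y]
      rcases Nat.eq_zero_or_pos j with rfl | hj
      · obtain ⟨r, rfl⟩ := Submodule.mem_one.1 (by rwa [pow_zero] at hy)
        simp [brk, Algebra.commutes r x]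
      have hxy := Submodule.mul_mem_mul hx hy
      have hyx := Submodule.mul_mem_mul hy hx
      rw [← pow_add] at hxy hyx
      exact sub_mem (range_ι_pow_le_degreeGE (by lia) hxy)
        (range_ι_pow_le_degreeGE (by lia) hyx)

theorem commute_prod_brk (g h : ℕ → ExteriorAlgebra R M) (n : ℕ) (a : ExteriorAlgebra R M) :
    Commute ((List.range n).map fun r => brk (g r) (h r)).prod a := by
  refine Commute.list_prod_left _ _ fun x hx => ?_
  obtain ⟨r, -, rfl⟩ := List.mem_map.1 hx
  exact commute_brk _ _ _

theorem prod_brk_mem_degreeGE (g h : ℕ → ExteriorAlgebra R M) (n : ℕ) :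
    ((List.range n).map fun r => brk (g r) (h r)).prod ∈ degreeGE R M (2 * n) := by
  induction n with
  | zero => simp [degreeGE]
  | succ n ih =>
    rw [List.range_succ, List.map_append, List.prod_append]
    simpa [mul_add] using mul_mem_degreeGE ih (brk_mem_degreeGE (g n) (h n))

end CommRing

variable {K V : Type*} [Field K] [AddCommGroup V] [Module K V] [FiniteDimensional K V]

theorem degreeGE_eq_bot {j : ℕ} (hj : Module.finrank K V < j) : degreeGE K V j = ⊥ := by
  have h : ⋀[K]^j V = ⊥ := by
    rw [← Submodule.finrank_eq_zero (R := K), exteriorPower.finrank_eq,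
      Nat.choose_eq_zero_of_lt hj]
  rw [degreeGE]
  exact (congrArg (· * ⊤) h).trans (Submodule.bot_mul _)

theorem commute_mul_prod_brk (c : ExteriorAlgebra K V) (g h : ℕ → ExteriorAlgebra K V) {n : ℕ}
    (hn : Module.finrank K V < 2 * (n + 1)) (a : ExteriorAlgebra K V) :
    Commute (c * ((List.range n).map fun r => brk (g r) (h r)).prod) a := by
  have hmem := mul_mem_degreeGE (brk_mem_degreeGE c a) (prod_brk_mem_degreeGE g h n)
  rw [degreeGE_eq_bot (by lia), Submodule.mem_bot, brk, sub_mul, sub_eq_zero] at hmem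
  change _ * _ * a = a * (_ * _)
  rw [mul_assoc, (commute_prod_brk g h n a).eq, ← mul_assoc, hmem, mul_assoc]

end ExteriorAlgebra

theorem map_brk {A B F : Type*} [Ring A] [Ring B] [FunLike F A B] [RingHomClass F A B] (f : F)
    (a b : A) : f (brk a b) = brk (f a) (f b) := by
  simp [brk]

/-- Let `k` be a field of characteristic `≠ 2`, `m ≥ 2`,
`b_m = ⌊m/2⌋ + 1`.  Then for all `g_0, g_1, …, g_{2(b_m-1)} ∈ G(m)` the element
`g_0 ∏_{r=1}^{b_m-1} [g_{2r-1}, g_{2r}]` is central in `G(m)`; consequently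
`x_{2b_m-1} h_{b_m-1} ∈ CP(G(m))`. -/
theorem stmt5 (k : Type*) [Field k] (hchar : ringChar k ≠ 2) (m : ℕ) (hm : 2 ≤ m) :
    (∀ g : ℕ → ExteriorAlgebra k (Fin m → k), ∀ a,
      (g 0 * ((List.range (m / 2 + 1 - 1)).map
          (fun r => brk (g (2 * r + 1)) (g (2 * r + 2)))).prod) * a =
      a * (g 0 * ((List.range (m / 2 + 1 - 1)).map
          (fun r => brk (g (2 * r + 1)) (g (2 * r + 2)))).prod)) ∧
    (xx k (2 * (m / 2 + 1) - 1) * hh k (m / 2 + 1 - 1)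
      ∈ {f : FreeAlgebra k ℕ |
          ∀ φ : FreeAlgebra k ℕ →ₐ[k] ExteriorAlgebra k (Fin m → k),
            ∀ a, φ f * a = a * φ f}) := by
  have hdim : Module.finrank k (Fin m → k) < 2 * (m / 2 + 1 - 1 + 1) := by
    rw [Module.finrank_fin_fun]
    lia
  refine ⟨fun g a => ExteriorAlgebra.commute_mul_prod_brk _ _ _ hdim a, fun φ a => ?_⟩
  have hφ : φ (hh k (m / 2 + 1 - 1)) = ((List.range (m / 2 + 1 - 1)).map fun r =>
      brk (φ (xx k (2 * r + 1))) (φ (xx k (2 * r + 2)))).prod := by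
    simp only [hh, map_list_prod, List.map_map, Function.comp_def, map_brk]
  rw [map_mul, hφ]
  exact ExteriorAlgebra.commute_mul_prod_brk _ _ _ hdim a

end
end
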